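/- Let A be an Artin algebra, D ⊆ mod A a 0-Igusa-Todorov subcategory, and C_1, C_2, E three subcategories of mod A such that for every E ∈ E there is an exact sequence 0 → C_1 → C_2 → E → 0 with C_i ∈ C_i for i = 1, 2. If C_1 is D-syzygy finite and gldim(C_2) < ∞, then E is D-syzygy finite. -/

import Mathlib

/-!
Common framework for formalizing "On Lat-Igusa-Todorov algebras" (Barrios–Mata).

For a ring `S`, `FGMod S` is the "category" of finitely generated (left) `S`-modules;
for an Artin algebra `A`, the category `mod A` of finitely generated *right*
`A`-modules is `FGMod Aᵐᵒᵖ`.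
-/

universe u v

open Function

namespace LIT

/-- The `η` invariant from Fitting's Lemma: for an endomorphism `L` of an abelian
group `G` and a subgroup `X`, the least `k` such that for all `m ≥ k` the
restriction of `L` to `L^m(X)` is a monomorphism `L^m(X) → L^{m+1}(X)`. -/
noncomputable def eta {G : Type v} [AddCommGroup G] (L : AddMonoid.End G)
    (X : AddSubgroup G) : ℕ :=
  sInf {k : ℕ | ∀ m : ℕ, k ≤ m → Set.InjOn L (X.map (L ^ m) : Set G)}

/-- Bundled finitely generated `S`-modules. -/
structure FGMod (S : Type u) [Ring S] : Type (u + 1) where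
  carrier : Type u
  [isAddCommGroup : AddCommGroup carrier]
  [isModule : Module S carrier]
  [isFinite : Module.Finite S carrier]

attribute [instance] FGMod.isAddCommGroup FGMod.isModule FGMod.isFinite

/-- The regular module `S` over itself. -/
def FGMod.regular (S : Type u) [Ring S] : FGMod S := ⟨S⟩

/-- A ring is finitely generated as a right module over itself. -/
instance (A : Type u) [Ring A] : Module.Finite Aᵐᵒᵖ A :=
  Module.Finite.of_surjective
    ({ toFun := MulOpposite.unop
       map_add' := fun _ _ => rfl
       map_smul' := fun _ _ => rfl } : Aᵐᵒᵖ →ₗ[Aᵐᵒᵖ] A)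
    (fun x => ⟨MulOpposite.op x, rfl⟩)

namespace FGMod

variable {S : Type u} [Ring S]

/-- Projectivity of a module. -/
def IsProj (M : FGMod S) : Prop := Module.Projective S M.carrier

/-- Direct sum (product) of two modules. -/
def prodMod (M N : FGMod S) : FGMod S := ⟨M.carrier × N.carrier⟩

/-- Finite direct sums. -/
def dsum {n : ℕ} (f : Fin n → FGMod S) : FGMod S := ⟨∀ i, (f i).carrier⟩

/-- `N` is a direct summand of `M`. -/
def IsSummand (N M : FGMod S) : Prop :=
  ∃ N' : FGMod S, Nonempty (M.carrier ≃ₗ[S] N.carrier × N'.carrier)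

/-- `addOf C` is `add C`: all direct summands of finite direct sums of modules of `C`. -/
def addOf (C : Set (FGMod S)) : Set (FGMod S) :=
  {N | ∃ (n : ℕ) (f : Fin n → FGMod S), (∀ i, f i ∈ C) ∧ IsSummand N (dsum f)}

/-- `f : P → M` is a projective cover: `P` projective, `f` surjective with superfluous kernel. -/
def IsProjCover {P M : FGMod S} (f : P.carrier →ₗ[S] M.carrier) : Prop :=
  P.IsProj ∧ Surjective f ∧
    ∀ N : Submodule S P.carrier, N ⊔ LinearMap.ker f = ⊤ → N = ⊤

/-- `N` is (isomorphic to) the syzygy `Ω(M)`, i.e. the kernel of a projective cover of `M`. -/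
def IsSyzygyOf (N M : FGMod S) : Prop :=
  ∃ (P : FGMod S) (f : P.carrier →ₗ[S] M.carrier),
    IsProjCover f ∧ Nonempty (N.carrier ≃ₗ[S] LinearMap.ker f)

/-- The syzygy `Ω(M)` of `M` (a choice of it; over an Artin algebra it exists and is
unique up to isomorphism). -/
noncomputable def syz (M : FGMod S) : FGMod S :=
  letI := Classical.propDecidable (∃ N, IsSyzygyOf N M)
  if h : ∃ N, IsSyzygyOf N M then h.choose else M

/-- `SES X Y Z` : there is a short exact sequence `0 → X → Y → Z → 0`. -/
def SES (X Y Z : FGMod S) : Prop :=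
  ∃ (f : X.carrier →ₗ[S] Y.carrier) (g : Y.carrier →ₗ[S] Z.carrier),
    Injective f ∧ Surjective g ∧ LinearMap.range f = LinearMap.ker g

/-- Projective dimension, via vanishing of syzygies. -/
noncomputable def pdim (M : FGMod S) : ℕ∞ :=
  sInf ((↑) '' {n : ℕ | (syz^[n] M).IsProj})

end FGMod

open FGMod

variable {S : Type u} [Ring S]

/-- The finitistic dimension of a class of modules: the supremum of the projective
dimensions of its modules of finite projective dimension. -/
noncomputable def findim (C : Set (FGMod S)) : ℕ∞ :=
  ⨆ M ∈ {M ∈ C | pdim M ≠ ⊤}, pdim M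

/-- The global dimension of a class of modules. -/
noncomputable def gldim (C : Set (FGMod S)) : ℕ∞ :=
  ⨆ M ∈ C, pdim M

/-- The defining relations of `K₀`: `[M] - [M'] - [M'']` for `M ≅ M' ⊕ M''`, and `[P]`
for `P` projective. -/
def K0Rels (S : Type u) [Ring S] : AddSubgroup (FreeAbelianGroup (FGMod S)) :=
  AddSubgroup.closure
    ({x | ∃ M M' M'' : FGMod S,
        Nonempty (M.carrier ≃ₗ[S] M'.carrier × M''.carrier) ∧
        x = FreeAbelianGroup.of M - FreeAbelianGroup.of M' - FreeAbelianGroup.of M''} ∪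
      {x | ∃ P : FGMod S, P.IsProj ∧ x = FreeAbelianGroup.of P})

/-- `K₀(A)`: the free abelian group on the modules modulo the relations above. -/
abbrev K0 (S : Type u) [Ring S] : Type (u + 1) :=
  FreeAbelianGroup (FGMod S) ⧸ K0Rels S

/-- The class `[M]` of a module in `K₀`. -/
def toK0 (M : FGMod S) : K0 S := QuotientAddGroup.mk (FreeAbelianGroup.of M)

/-- `⟨C⟩`: the subgroup of `K₀` generated by the classes of direct summands of
modules of `C`. -/
def grpOf (C : Set (FGMod S)) : AddSubgroup (K0 S) :=
  AddSubgroup.closure {x | ∃ N M : FGMod S, M ∈ C ∧ IsSummand N M ∧ x = toK0 N}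

/-- `K_D = K₀/⟨D⟩`. -/
abbrev KD (D : Set (FGMod S)) : Type (u + 1) := K0 S ⧸ grpOf D

/-- The class of a module in `K_D`. -/
def toKD (D : Set (FGMod S)) (M : FGMod S) : KD D :=
  QuotientAddGroup.mk (toK0 M)

/-- `L` is the endomorphism `Ω̄` of `K₀` induced by the syzygy operator (it is unique). -/
def IsSyzEnd (L : AddMonoid.End (K0 S)) : Prop :=
  ∀ M : FGMod S, L (toK0 M) = toK0 (syz M)

/-- `L` is the endomorphism `Ω̄_D` of `K_D` induced by the syzygy operator. -/
def IsSyzEndD (D : Set (FGMod S)) (L : AddMonoid.End (KD D)) : Prop :=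
  ∀ M : FGMod S, L (toKD D M) = toKD D (syz M)

/-- The Igusa–Todorov function `φ`, relative to the induced endomorphism `L = Ω̄` of `K₀`. -/
noncomputable def phi (L : AddMonoid.End (K0 S)) (M : FGMod S) : ℕ :=
  eta L (grpOf {M})

/-- `φ`-dimension of a class of modules. -/
noncomputable def phidim (L : AddMonoid.End (K0 S)) (C : Set (FGMod S)) : ℕ∞ :=
  ⨆ M ∈ C, (phi L M : ℕ∞)

/-- The generalized Igusa–Todorov function `φ_[D]`, relative to `L = Ω̄_D`. -/
noncomputable def phiD (D : Set (FGMod S)) (L : AddMonoid.End (KD D)) (M : FGMod S) : ℕ :=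
  eta L ((grpOf {M}).map (QuotientAddGroup.mk' (grpOf D)))

/-- The generalized Igusa–Todorov function `ψ_[D]`. -/
noncomputable def psiD (D : Set (FGMod S)) (L : AddMonoid.End (KD D)) (M : FGMod S) : ℕ∞ :=
  (phiD D L M : ℕ∞) + findim (addOf {syz^[phiD D L M] M})

/-- `D` is a `0`-Igusa–Todorov subcategory: `D = add D`, `Ω(D) ⊆ D` and `φdim D = 0`. -/
def IsZeroIT (L : AddMonoid.End (K0 S)) (D : Set (FGMod S)) : Prop :=
  D = addOf D ∧ (∀ M ∈ D, syz M ∈ D) ∧ phidim L D = 0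

/-- The class `C` is `(n,V,D)`-Lat-Igusa-Todorov: every `M ∈ C` admits an exact sequence
`0 → V₁ ⊕ D₁ → V₀ ⊕ D₀ → Ωⁿ(M) → 0` with `V₁, V₀ ∈ add V` and `D₁, D₀ ∈ D`. -/
def IsLITClass (n : ℕ) (V : FGMod S) (D : Set (FGMod S)) (C : Set (FGMod S)) : Prop :=
  ∀ M ∈ C, ∃ V1 V0 D1 D0 : FGMod S,
    V1 ∈ addOf {V} ∧ V0 ∈ addOf {V} ∧ D1 ∈ D ∧ D0 ∈ D ∧
    SES (prodMod V1 D1) (prodMod V0 D0) (syz^[n] M)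

/-- `[C]_D`: the image of `⟨C⟩` in `K_D`, i.e. `(⟨C⟩ + ⟨D⟩)/⟨D⟩`. -/
def classGrpD (D C : Set (FGMod S)) : AddSubgroup (KD D) :=
  (grpOf C).map (QuotientAddGroup.mk' (grpOf D))

/-- `C` is `D`-syzygy finite: `[Ω^k(C)]_D` is finitely generated for some `k`. -/
def DSyzFinite (D C : Set (FGMod S)) : Prop :=
  ∃ k : ℕ, (classGrpD D ((fun M => syz^[k] M) '' C)).FG

/-- The algebra is `n`-LIT: there are a `0`-Igusa–Todorov subcategory `D` and a module `V`
such that `mod A` is `(n,V,D)`-LIT. -/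
def IsNLITAlgebra (L : AddMonoid.End (K0 S)) (n : ℕ) : Prop :=
  ∃ (V : FGMod S) (D : Set (FGMod S)), IsZeroIT L D ∧ IsLITClass n V D Set.univ

/-- The algebra is LIT: it is `n`-LIT for some `n`. -/
def IsLITAlgebra (L : AddMonoid.End (K0 S)) : Prop :=
  ∃ n : ℕ, IsNLITAlgebra L n

namespace FGMod

/-- A submodule of a finitely generated module over a Noetherian ring. -/
def ofSub [IsNoetherianRing S] (M : FGMod S) (N : Submodule S M.carrier) : FGMod S := ⟨N⟩

theorem IsSummand.exists_retraction {N M : FGMod S} (h : IsSummand N M) :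
    ∃ (i : N.carrier →ₗ[S] M.carrier) (p : M.carrier →ₗ[S] N.carrier), p ∘ₗ i = LinearMap.id := by
  obtain ⟨N', ⟨e⟩⟩ := h
  refine ⟨e.symm.toLinearMap ∘ₗ LinearMap.inl S _ _, LinearMap.fst S _ _ ∘ₗ e.toLinearMap, ?_⟩
  ext x
  simp

/-- The splitting of a module induced by a retraction. -/
def retractionEquiv {N M : Type*} [AddCommGroup N] [AddCommGroup M] [Module S N] [Module S M]
    (i : N →ₗ[S] M) (p : M →ₗ[S] N) (h : p ∘ₗ i = LinearMap.id) :
    M ≃ₗ[S] N × LinearMap.ker p :=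
  have h' : ∀ x, p (i x) = x := fun x => LinearMap.congr_fun h x
  LinearEquiv.ofLinearMap
    (p.prod (LinearMap.codRestrict (LinearMap.ker p) (LinearMap.id - i ∘ₗ p)
      (fun x => by simp [h'])))
    (i.coprod (LinearMap.ker p).subtype)
    (by ext x <;> simp [h']) (by ext x; simp)

theorem IsSummand.of_retraction [IsNoetherianRing S] {N M : FGMod S}
    (i : N.carrier →ₗ[S] M.carrier) (p : M.carrier →ₗ[S] N.carrier)
    (h : p ∘ₗ i = LinearMap.id) : IsSummand N M :=
  ⟨ofSub M (LinearMap.ker p), ⟨retractionEquiv i p h⟩⟩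

theorem IsSummand.of_equiv {N M : FGMod S} (e : M.carrier ≃ₗ[S] N.carrier) : IsSummand N M :=
  ⟨⟨PUnit⟩,
    ⟨e.trans (LinearEquiv.prodUnique (R := S) (M := N.carrier) (M₂ := PUnit.{u + 1})).symm⟩⟩

theorem IsSummand.prod_left (M N : FGMod S) : IsSummand M (prodMod M N) :=
  ⟨N, ⟨LinearEquiv.refl S _⟩⟩

theorem IsSummand.trans [IsNoetherianRing S] {M N K : FGMod S} (h : IsSummand M N)
    (h' : IsSummand N K) : IsSummand M K := by
  obtain ⟨i, p, hp⟩ := h.exists_retraction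
  obtain ⟨j, q, hq⟩ := h'.exists_retraction
  refine .of_retraction (j ∘ₗ i) (p ∘ₗ q) ?_
  rw [LinearMap.comp_assoc, ← LinearMap.comp_assoc i j q, hq, LinearMap.id_comp, hp]

theorem IsProj.of_isSummand {M N : FGMod S} (h : IsSummand M N) (hN : N.IsProj) : M.IsProj := by
  obtain ⟨i, p, hp⟩ := h.exists_retraction
  have : Module.Projective S N.carrier := hN
  exact Module.Projective.of_split i p hp

theorem IsProj.prodMod {M N : FGMod S} (hM : M.IsProj) (hN : N.IsProj) :
    (prodMod M N).IsProj := by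
  have : Module.Projective S M.carrier := hM
  have : Module.Projective S N.carrier := hN
  exact inferInstanceAs (Module.Projective S (M.carrier × N.carrier))

/-- Indecomposability of a module. -/
def Indec (M : FGMod S) : Prop :=
  Nontrivial M.carrier ∧ ∀ M₁ M₂ : FGMod S, Nonempty (M.carrier ≃ₗ[S] M₁.carrier × M₂.carrier) →
    Subsingleton M₁.carrier ∨ Subsingleton M₂.carrier

theorem Indec.isUnit_or_isNilpotent [IsArtinianRing S] {Z : FGMod S} (hZ : Z.Indec)
    (e : Module.End S Z.carrier) : IsUnit e ∨ IsNilpotent e := by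
  obtain ⟨n, hn, hn1⟩ := ((LinearMap.eventually_isCompl_ker_pow_range_pow e).and
    (Filter.eventually_ge_atTop 1)).exists
  have key := hZ.2 (ofSub Z (LinearMap.ker (e ^ n))) (ofSub Z (LinearMap.range (e ^ n)))
    ⟨(Submodule.prodEquivOfIsCompl _ _ hn).symm⟩
  rcases key with h | h
  · left
    have hk : LinearMap.ker (e ^ n) = ⊥ := Submodule.subsingleton_iff_eq_bot.1 h
    rw [← isUnit_pow_iff (n := n) (by omega), Module.End.isUnit_iff]
    refine ⟨LinearMap.ker_eq_bot.1 hk, LinearMap.range_eq_top.1 ?_⟩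
    rw [hk] at hn
    simpa using hn.sup_eq_top
  · right
    exact ⟨n, LinearMap.range_eq_bot.1 (Submodule.subsingleton_iff_eq_bot.1 h)⟩

theorem Indec.isLocalRing [IsArtinianRing S] {Z : FGMod S} (hZ : Z.Indec) :
    IsLocalRing (Module.End S Z.carrier) := by
  have := hZ.1
  refine ⟨fun {a b} hab => ?_⟩
  rcases hZ.isUnit_or_isNilpotent a with h | h
  · exact Or.inl h
  · right
    rw [eq_sub_of_add_eq' hab]
    exact h.isUnit_one_sub

theorem Indec.isSummand_of_isUnit [IsNoetherianRing S] {Z M : FGMod S}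
    (f : Z.carrier →ₗ[S] M.carrier) (g : M.carrier →ₗ[S] Z.carrier)
    (h : IsUnit (g ∘ₗ f : Module.End S Z.carrier)) : IsSummand Z M := by
  obtain ⟨u, hu⟩ := h
  refine .of_retraction f ((↑u⁻¹ : Module.End S Z.carrier) ∘ₗ g) ?_
  rw [LinearMap.comp_assoc, ← hu]
  exact u.inv_mul

theorem Indec.isSummand_prod [IsArtinianRing S] {Z M N K : FGMod S} (hZ : Z.Indec)
    (e : K.carrier ≃ₗ[S] M.carrier × N.carrier) (h : IsSummand Z K) :
    IsSummand Z M ∨ IsSummand Z N := by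
  obtain ⟨i, p, hp⟩ := h.exists_retraction
  have := hZ.isLocalRing
  have hsum : ((p ∘ₗ e.symm.toLinearMap ∘ₗ LinearMap.inl S _ _) ∘ₗ
      (LinearMap.fst S _ _ ∘ₗ e.toLinearMap ∘ₗ i) : Module.End S Z.carrier) +
      (p ∘ₗ e.symm.toLinearMap ∘ₗ LinearMap.inr S _ _) ∘ₗ
      (LinearMap.snd S _ _ ∘ₗ e.toLinearMap ∘ₗ i) = 1 := by
    ext x
    simp only [LinearMap.add_apply, LinearMap.comp_apply, ← map_add]
    have : p (i x) = x := LinearMap.congr_fun hp x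
    simp [this]
  exact (IsLocalRing.isUnit_or_isUnit_of_add_one hsum).imp
    (isSummand_of_isUnit _ _) (isSummand_of_isUnit _ _)

theorem Indec.not_isSummand_of_subsingleton {Z M : FGMod S} (hZ : Z.Indec)
    (hM : Subsingleton M.carrier) : ¬ IsSummand Z M := by
  rintro ⟨N', ⟨e⟩⟩
  have := hZ.1
  exact not_subsingleton (Z.carrier × N'.carrier) e.symm.injective.subsingleton

theorem Indec.nonempty_equiv_of_isSummand {Z M : FGMod S} (hZ : Z.Indec) (hM : M.Indec)
    (h : IsSummand Z M) : Nonempty (M.carrier ≃ₗ[S] Z.carrier) := by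
  obtain ⟨N', ⟨e⟩⟩ := h
  have := hZ.1
  rcases hM.2 _ _ ⟨e⟩ with h | h
  · exact absurd h (not_subsingleton _)
  · have : Unique N'.carrier := @Unique.mk' _ ⟨0⟩ h
    exact ⟨e.trans LinearEquiv.prodUnique⟩

theorem indecInduction [IsArtinianRing S] {P : FGMod S → Prop}
    (zero : ∀ M : FGMod S, Subsingleton M.carrier → P M)
    (indec : ∀ M : FGMod S, M.Indec → P M)
    (prod : ∀ M M₁ M₂ : FGMod S, Nonempty (M.carrier ≃ₗ[S] M₁.carrier × M₂.carrier) →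
      P M₁ → P M₂ → P M) (M : FGMod S) : P M := by
  induction h : Module.length S M.carrier using WellFoundedLT.induction generalizing M with
  | ind l ih =>
  rcases subsingleton_or_nontrivial M.carrier with h0 | h0
  · exact zero M h0
  by_cases hM : M.Indec
  · exact indec M hM
  simp only [Indec, h0, true_and, not_forall, not_or, not_subsingleton_iff_nontrivial] at hM
  obtain ⟨M₁, M₂, ⟨e⟩, h₁, h₂⟩ := hM
  have hl := e.length_eq
  rw [Module.length_prod, h] at hl
  have t₁ : Module.length S M₁.carrier ≠ ⊤ := Module.length_ne_top
  have t₂ : Module.length S M₂.carrier ≠ ⊤ := Module.length_ne_top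
  have p₁ : Module.length S M₁.carrier > 0 := Module.length_pos
  have p₂ : Module.length S M₂.carrier > 0 := Module.length_pos
  refine prod M M₁ M₂ ⟨e⟩ (ih _ ?_ M₁ rfl) (ih _ ?_ M₂ rfl)
  · rw [hl]
    exact add_comm (Module.length S M₁.carrier) _ ▸ ENat.lt_add_left t₁ p₂
  · rw [hl]
    exact ENat.lt_add_left t₂ p₁

theorem exists_isProjCover_of_surjective [IsArtinianRing S] {M : FGMod S} (P : FGMod S)
    (f : P.carrier →ₗ[S] M.carrier) (hP : P.IsProj) (hf : Surjective f) :
    ∃ (Q : FGMod S) (g : Q.carrier →ₗ[S] M.carrier), IsProjCover g := by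
  induction h : Module.length S P.carrier using WellFoundedLT.induction generalizing P with
  | ind l ih =>
  by_cases hc : IsProjCover f
  · exact ⟨P, f, hc⟩
  simp only [IsProjCover, hP, hf, true_and, not_forall] at hc
  obtain ⟨N, hN, hne⟩ := hc
  have hsurj : Surjective (f ∘ₗ N.subtype) := by
    intro m
    obtain ⟨x, rfl⟩ := hf m
    obtain ⟨y, hy, z, hz, rfl⟩ := Submodule.mem_sup.1 (hN ▸ Submodule.mem_top (x := x))
    exact ⟨⟨y, hy⟩, by simp [LinearMap.mem_ker.1 hz]⟩
  have : Module.Projective S P.carrier := hP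
  obtain ⟨k, hk⟩ := Module.projective_lifting_property (f ∘ₗ N.subtype) f hsurj
  set g : Module.End S P.carrier := N.subtype ∘ₗ k with hg
  have hfg : ∀ x, f (g x) = f x := fun x => LinearMap.congr_fun hk x
  have hfgn : ∀ n x, f ((g ^ n) x) = f x := by
    intro n
    induction n with
    | zero => simp
    | succ n ihn => intro x; rw [pow_succ', Module.End.mul_apply, hfg, ihn]
  obtain ⟨n, hn, hn1⟩ := ((LinearMap.eventually_isCompl_ker_pow_range_pow g).and
    (Filter.eventually_ge_atTop 1)).exists
  have hle : LinearMap.range (g ^ n) ≤ N := by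
    obtain ⟨m, rfl⟩ := Nat.exists_eq_add_of_le' hn1
    rintro _ ⟨x, rfl⟩
    rw [pow_succ', Module.End.mul_apply]
    exact (k _).2
  have hsum : IsSummand (ofSub P (LinearMap.range (g ^ n))) P :=
    ⟨ofSub P (LinearMap.ker (g ^ n)), ⟨(Submodule.prodEquivOfIsCompl _ _ hn.symm).symm⟩⟩
  refine ih _ ?_ (ofSub P (LinearMap.range (g ^ n))) (f ∘ₗ Submodule.subtype _)
    (hP.of_isSummand hsum) ?_ rfl
  · rw [← h]
    exact Submodule.length_lt (fun ht => hne (top_le_iff.1 (ht ▸ hle)))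
  · intro m
    obtain ⟨x, rfl⟩ := hf m
    exact ⟨⟨(g ^ n) x, x, rfl⟩, hfgn n x⟩

theorem exists_isSyzygyOf [IsArtinianRing S] (M : FGMod S) : ∃ N, IsSyzygyOf N M := by
  obtain ⟨n, f, hf⟩ := Module.Finite.exists_fin' S M.carrier
  obtain ⟨P, g, hg⟩ := exists_isProjCover_of_surjective (M := M) ⟨Fin n → S⟩ f
    (inferInstanceAs (Module.Projective S (Fin n → S))) hf
  exact ⟨ofSub P (LinearMap.ker g), P, g, hg, ⟨LinearEquiv.refl S _⟩⟩

theorem SES.exists_syz [IsArtinianRing S] (M : FGMod S) :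
    ∃ P : FGMod S, P.IsProj ∧ SES (syz M) P M := by
  have h := exists_isSyzygyOf M
  have hs : IsSyzygyOf (syz M) M := by
    rw [syz, dif_pos h]
    exact h.choose_spec
  obtain ⟨P, f, hf, ⟨e⟩⟩ := hs
  refine ⟨P, hf.1, (LinearMap.ker f).subtype ∘ₗ e.toLinearMap, f, ?_, hf.2.1, ?_⟩
  · exact Subtype.val_injective.comp e.injective
  · rw [LinearMap.range_comp_of_range_eq_top _ e.range, Submodule.range_subtype]

theorem SES.rotate {X Y M K P : FGMod S} (h : SES X Y M) (hP : P.IsProj) (h' : SES K P M) :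
    SES K (prodMod X P) Y := by
  obtain ⟨f, g, hf, hg, hfg⟩ := h
  obtain ⟨a, b, ha, hb, hab⟩ := h'
  have : Module.Projective S P.carrier := hP
  obtain ⟨s, hs⟩ := Module.projective_lifting_property g b hg
  have hs' : ∀ p, g (s p) = b p := fun p => LinearMap.congr_fun hs p
  have hgf : ∀ x, g (f x) = 0 := fun x =>
    LinearMap.mem_ker.1 (hfg ▸ LinearMap.mem_range_self f x)
  have hba : ∀ x, b (a x) = 0 := fun x =>
    LinearMap.mem_ker.1 (hab ▸ LinearMap.mem_range_self a x)
  let c : K.carrier →ₗ[S] X.carrier := (LinearEquiv.ofInjective f hf).symm.toLinearMap ∘ₗ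
    LinearMap.codRestrict (LinearMap.range f) (-(s ∘ₗ a)) (fun k => by
      rw [hfg, LinearMap.mem_ker]
      simp [hs', hba])
  have hc : ∀ k, f (c k) = -s (a k) := fun k => by
    have := LinearEquiv.ofInjective_symm_apply (f := f) (h := hf)
      (LinearMap.codRestrict (LinearMap.range f) (-(s ∘ₗ a)) (fun k => by
      rw [hfg, LinearMap.mem_ker]
      simp [hs', hba]) k)
    exact this
  refine ⟨c.prod a, f.coprod s, ?_, ?_, ?_⟩
  · exact fun x y hxy => ha (congrArg Prod.snd hxy)
  · intro y
    obtain ⟨p, hp⟩ := hb (g y)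
    have hy : y - s p ∈ LinearMap.range f := by
      rw [hfg, LinearMap.mem_ker, map_sub, hs', hp, sub_self]
    obtain ⟨x, hx⟩ := hy
    exact ⟨(x, p), show f x + s p = y by rw [hx, sub_add_cancel]⟩
  · ext ⟨x, p⟩
    constructor
    · rintro ⟨k, hk⟩
      obtain ⟨rfl, rfl⟩ := Prod.mk.inj hk
      exact show f (c k) + s (a k) = 0 by rw [hc, neg_add_cancel]
    · intro (hxp : f x + s p = 0)
      have hp : p ∈ LinearMap.range a := by
        have := congrArg g hxp
        rw [map_add, hgf, hs', zero_add, map_zero] at this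
        rwa [hab]
      obtain ⟨k, rfl⟩ := hp
      have hx : c k = x := hf (by rw [hc, eq_neg_of_add_eq_zero_left hxp])
      exact ⟨k, Prod.ext hx rfl⟩

theorem SES.nonempty_equiv_prod {K W Y : FGMod S} (h : SES K W Y) (hY : Y.IsProj) :
    Nonempty (W.carrier ≃ₗ[S] K.carrier × Y.carrier) := by
  obtain ⟨f, g, hf, hg, hfg⟩ := h
  have : Module.Projective S Y.carrier := hY
  obtain ⟨t, ht⟩ := g.exists_rightInverse_of_surjective (LinearMap.range_eq_top.2 hg)
  exact ⟨((retractionEquiv t g ht).trans (LinearEquiv.prodComm S _ _)).trans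
    (LinearEquiv.prodCongr ((LinearEquiv.ofEq _ _ hfg.symm).trans
      (LinearEquiv.ofInjective f hf).symm) (LinearEquiv.refl S _))⟩

theorem SES.congr_right {X Y Z Z' : FGMod S} (h : SES X Y Z) (e : Z.carrier ≃ₗ[S] Z'.carrier) :
    SES X Y Z' := by
  obtain ⟨f, g, hf, hg, hfg⟩ := h
  exact ⟨f, e.toLinearMap ∘ₗ g, hf, e.surjective.comp hg, by rw [hfg, LinearEquiv.ker_comp]⟩

theorem SES.prod {X Y Z X' Y' Z' : FGMod S} (h : SES X Y Z) (h' : SES X' Y' Z') :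
    SES (prodMod X X') (prodMod Y Y') (prodMod Z Z') := by
  obtain ⟨f, g, hf, hg, hfg⟩ := h
  obtain ⟨f', g', hf', hg', hfg'⟩ := h'
  have h : LinearMap.range (f.prodMap f') = LinearMap.ker (g.prodMap g') := by
    rw [LinearMap.range_prodMap, LinearMap.ker_prodMap, hfg, hfg']
  exact ⟨f.prodMap f', g.prodMap g', hf.prodMap hf', hg.prodMap hg', h⟩

/-- The zero module. -/
def zeroMod (S : Type u) [Ring S] : FGMod S := ⟨PUnit⟩

theorem isProj_of_subsingleton {M : FGMod S} (h : Subsingleton M.carrier) : M.IsProj :=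
  Module.Projective.of_free

theorem isProj_zeroMod : (zeroMod S).IsProj :=
  isProj_of_subsingleton (inferInstanceAs (Subsingleton PUnit))

theorem SES.zero_left (P : FGMod S) : SES (zeroMod S) P P :=
  ⟨0, LinearMap.id, fun _ _ _ => rfl, surjective_id, by
    rw [LinearMap.range_zero, LinearMap.ker_id]⟩

/-- Two modules are stably isomorphic if they become isomorphic after adding projectives. -/
def Stable (M N : FGMod S) : Prop :=
  ∃ P Q : FGMod S, P.IsProj ∧ Q.IsProj ∧
    Nonempty ((M.carrier × P.carrier) ≃ₗ[S] N.carrier × Q.carrier)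

theorem Stable.symm {M N : FGMod S} (h : Stable M N) : Stable N M := by
  obtain ⟨P, Q, hP, hQ, ⟨e⟩⟩ := h
  exact ⟨Q, P, hQ, hP, ⟨e.symm⟩⟩

theorem Stable.trans {M N K : FGMod S} (h : Stable M N) (h' : Stable N K) : Stable M K := by
  obtain ⟨P, Q, hP, hQ, ⟨e⟩⟩ := h
  obtain ⟨P', Q', hP', hQ', ⟨e'⟩⟩ := h'
  refine ⟨prodMod P P', prodMod Q' Q, hP.prodMod hP', hQ'.prodMod hQ, ⟨?_⟩⟩
  exact (LinearEquiv.prodAssoc S M.carrier P.carrier P'.carrier).symm.trans <|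
    (LinearEquiv.prodCongr e (LinearEquiv.refl S _)).trans <|
    (LinearEquiv.prodAssoc S N.carrier Q.carrier P'.carrier).trans <|
    (LinearEquiv.prodCongr (LinearEquiv.refl S _) (LinearEquiv.prodComm S _ _)).trans <|
    (LinearEquiv.prodAssoc S N.carrier P'.carrier Q.carrier).symm.trans <|
    (LinearEquiv.prodCongr e' (LinearEquiv.refl S _)).trans <|
    (LinearEquiv.prodAssoc S K.carrier Q'.carrier Q.carrier)

theorem Stable.prod_proj (M : FGMod S) {P : FGMod S} (hP : P.IsProj) :
    Stable (prodMod M P) M :=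
  ⟨zeroMod S, prodMod P (zeroMod S), isProj_zeroMod, hP.prodMod isProj_zeroMod,
    ⟨LinearEquiv.prodAssoc S M.carrier P.carrier (zeroMod S).carrier⟩⟩

theorem Stable.isProj {M N : FGMod S} (h : Stable M N) (hN : N.IsProj) : M.IsProj := by
  obtain ⟨P, Q, hP, hQ, ⟨e⟩⟩ := h
  exact (hN.prodMod hQ).of_isSummand ⟨P, ⟨e.symm⟩⟩

theorem Stable.isSummand_or_isProj [IsArtinianRing S] {Z M N : FGMod S} (h : Stable M N)
    (hZ : Z.Indec) (hM : IsSummand Z M) : IsSummand Z N ∨ Z.IsProj := by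
  obtain ⟨P, Q, hP, hQ, ⟨e⟩⟩ := h
  exact (hZ.isSummand_prod (K := prodMod M P) e (hM.trans (.prod_left M P))).imp_right
    hQ.of_isSummand

theorem SES.stable {K P K' P' M : FGMod S} (h : SES K P M) (hP : P.IsProj) (h' : SES K' P' M)
    (hP' : P'.IsProj) : Stable K K' := by
  obtain ⟨e⟩ := (h'.rotate hP h).nonempty_equiv_prod hP'
  exact ⟨P', P, hP', hP, ⟨e.symm⟩⟩

theorem Stable.syz [IsArtinianRing S] {M N : FGMod S} (h : Stable M N) :
    Stable (syz M) (syz N) := by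
  obtain ⟨P, Q, hP, hQ, ⟨e⟩⟩ := h
  obtain ⟨P₁, hP₁, h₁⟩ := SES.exists_syz M
  obtain ⟨P₂, hP₂, h₂⟩ := SES.exists_syz N
  have h₁' := (h₁.prod (SES.zero_left P)).congr_right (Z' := prodMod N Q) e
  have h₂' := h₂.prod (SES.zero_left Q)
  exact ((Stable.prod_proj _ isProj_zeroMod).symm.trans
    (h₁'.stable (hP₁.prodMod hP) h₂' (hP₂.prodMod hQ))).trans
    (Stable.prod_proj _ isProj_zeroMod)

theorem stable_syz_prod [IsArtinianRing S] {M M₁ M₂ : FGMod S}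
    (e : M.carrier ≃ₗ[S] M₁.carrier × M₂.carrier) :
    Stable (syz M) (prodMod (syz M₁) (syz M₂)) := by
  obtain ⟨P, hP, h⟩ := SES.exists_syz M
  obtain ⟨P₁, hP₁, h₁⟩ := SES.exists_syz M₁
  obtain ⟨P₂, hP₂, h₂⟩ := SES.exists_syz M₂
  exact (h.congr_right (Z' := prodMod M₁ M₂) e).stable hP (h₁.prod h₂) (hP₁.prodMod hP₂)

theorem IsProj.syz [IsArtinianRing S] {M : FGMod S} (hM : M.IsProj) : (syz M).IsProj := by
  obtain ⟨P, hP, h⟩ := SES.exists_syz M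
  exact (h.stable hP (SES.zero_left M) hM).isProj isProj_zeroMod

theorem Stable.syz_iterate [IsArtinianRing S] {M N : FGMod S} (h : Stable M N) (n : ℕ) :
    Stable (FGMod.syz^[n] M) (FGMod.syz^[n] N) := by
  induction n generalizing M N with
  | zero => exact h
  | succ n ih => exact ih h.syz

theorem SES.stable_syz_iterate [IsArtinianRing S] {X Y M : FGMod S} (h : SES X Y M) (n : ℕ)
    (hY : (FGMod.syz^[n] Y).IsProj) : Stable (FGMod.syz^[n + 1] M) (FGMod.syz^[n] X) := by
  induction n generalizing X Y M with
  | zero =>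
    obtain ⟨P, hP, h'⟩ := SES.exists_syz M
    exact h'.stable hP h hY
  | succ n ih =>
    obtain ⟨P₁, hP₁, h₁⟩ := SES.exists_syz M
    obtain ⟨P₂, hP₂, h₂⟩ := SES.exists_syz Y
    obtain ⟨P₃, hP₃, h₃⟩ := SES.exists_syz (prodMod X P₁)
    have key := ((h.rotate hP₁ h₁).rotate hP₂ h₂).rotate hP₃ h₃
    have := ih key (((Stable.prod_proj _ hP₃).syz_iterate n).isProj hY)
    exact (((Stable.prod_proj _ hP₂).syz_iterate (n + 1)).symm.trans this).trans
      ((Stable.prod_proj X hP₁).syz_iterate (n + 1))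

end FGMod

theorem finite_linearMap (R Z M : Type*) [CommRing R] [IsNoetherianRing R] [Algebra R S]
    [AddCommGroup Z] [AddCommGroup M] [Module S Z] [Module S M] [Module R M] [IsScalarTower R S M]
    [Module.Finite R M] [Module.Finite S Z] :
    Module.Finite R (Z →ₗ[S] M) := by
  obtain ⟨n, s, hs⟩ := Module.Finite.exists_fin (R := S) (M := Z)
  let ev : (Z →ₗ[S] M) →ₗ[R] (Fin n → M) :=
    { toFun := fun f i => f (s i)
      map_add' := fun _ _ => rfl
      map_smul' := fun _ _ => rfl }
  refine Module.Finite.of_injective ev fun f g hfg => ?_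
  refine LinearMap.ext_on_range hs fun i => ?_
  exact congrFun hfg i

section Multiplicity

variable (R : Type*) {Z M M₁ M₂ : Type*} [CommRing R] [Algebra R S]
  [AddCommGroup Z] [AddCommGroup M] [AddCommGroup M₁] [AddCommGroup M₂]
  [Module S Z] [Module S M] [Module S M₁] [Module S M₂]
  [Module R Z] [Module R M] [Module R M₁] [Module R M₂]
  [IsScalarTower R S Z] [IsScalarTower R S M] [IsScalarTower R S M₁] [IsScalarTower R S M₂]

variable (S Z M) in
/-- The radical of `Hom(Z, M)` for `Z` with local endomorphism ring. -/
def radHom [IsLocalRing (Module.End S Z)] : Submodule R (Z →ₗ[S] M) where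
  carrier := {f | ∀ g : M →ₗ[S] Z, ¬ IsUnit (g ∘ₗ f : Module.End S Z)}
  add_mem' {f f'} hf hf' g hg := by
    rw [LinearMap.comp_add] at hg
    exact (IsLocalRing.isUnit_or_isUnit_of_isUnit_add hg).elim (hf g) (hf' g)
  zero_mem' g hg := by
    rw [LinearMap.comp_zero] at hg
    exact not_isUnit_zero hg
  smul_mem' r f hf g hg := by
    refine hf (r • g) ?_
    rwa [LinearMap.smul_comp, ← LinearMap.comp_smul]

/-- Postcomposition as an `R`-linear map. -/
def postComp (h : M →ₗ[S] M₁) : (Z →ₗ[S] M) →ₗ[R] (Z →ₗ[S] M₁) where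
  toFun f := h ∘ₗ f
  map_add' _ _ := LinearMap.comp_add _ _ _
  map_smul' _ _ := LinearMap.comp_smul _ _ _

variable (S Z) in
theorem length_quotient_radHom_add [IsLocalRing (Module.End S Z)] (e : M ≃ₗ[S] M₁ × M₂) :
    Module.length R ((Z →ₗ[S] M) ⧸ radHom S R Z M) =
      Module.length R ((Z →ₗ[S] M₁) ⧸ radHom S R Z M₁) +
        Module.length R ((Z →ₗ[S] M₂) ⧸ radHom S R Z M₂) := by
  let p₁ : M →ₗ[S] M₁ := LinearMap.fst S M₁ M₂ ∘ₗ e.toLinearMap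
  let p₂ : M →ₗ[S] M₂ := LinearMap.snd S M₁ M₂ ∘ₗ e.toLinearMap
  let i₁ : M₁ →ₗ[S] M := e.symm.toLinearMap ∘ₗ LinearMap.inl S M₁ M₂
  let i₂ : M₂ →ₗ[S] M := e.symm.toLinearMap ∘ₗ LinearMap.inr S M₁ M₂
  have hid : i₁ ∘ₗ p₁ + i₂ ∘ₗ p₂ = LinearMap.id := by
    ext x
    simp only [i₁, i₂, p₁, p₂, LinearMap.add_apply, LinearMap.comp_apply, ← map_add]
    simp
  have h₁₁ : p₁ ∘ₗ i₁ = LinearMap.id := by ext; simp [p₁, i₁]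
  have h₁₂ : p₁ ∘ₗ i₂ = 0 := by ext; simp [p₁, i₂]
  have h₂₁ : p₂ ∘ₗ i₁ = 0 := by ext; simp [p₂, i₁]
  have h₂₂ : p₂ ∘ₗ i₂ = LinearMap.id := by ext; simp [p₂, i₂]
  clear_value p₁ p₂ i₁ i₂
  let Φ := ((radHom S R Z M₁).mkQ ∘ₗ postComp R (Z := Z) p₁).prod
    ((radHom S R Z M₂).mkQ ∘ₗ postComp R (Z := Z) p₂)
  have hΦ : Surjective Φ := by
    rintro ⟨x, y⟩
    obtain ⟨f₁, rfl⟩ := Submodule.mkQ_surjective _ x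
    obtain ⟨f₂, rfl⟩ := Submodule.mkQ_surjective _ y
    refine ⟨i₁ ∘ₗ f₁ + i₂ ∘ₗ f₂, Prod.ext (congrArg (Submodule.mkQ _) ?_)
      (congrArg (Submodule.mkQ _) ?_)⟩
    · change p₁ ∘ₗ (i₁ ∘ₗ f₁ + i₂ ∘ₗ f₂) = f₁
      rw [LinearMap.comp_add, ← LinearMap.comp_assoc, ← LinearMap.comp_assoc, h₁₁, h₁₂,
        LinearMap.id_comp, LinearMap.zero_comp, add_zero]
    · change p₂ ∘ₗ (i₁ ∘ₗ f₁ + i₂ ∘ₗ f₂) = f₂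
      rw [LinearMap.comp_add, ← LinearMap.comp_assoc, ← LinearMap.comp_assoc, h₂₁, h₂₂,
        LinearMap.id_comp, LinearMap.zero_comp, zero_add]
  have hker : LinearMap.ker Φ = radHom S R Z M := by
    ext f
    rw [LinearMap.ker_prod, Submodule.mem_inf, LinearMap.ker_comp, LinearMap.ker_comp,
      Submodule.ker_mkQ, Submodule.ker_mkQ, Submodule.mem_comap, Submodule.mem_comap]
    constructor
    · rintro ⟨hf₁, hf₂⟩ g hg
      have : g ∘ₗ f = (g ∘ₗ i₁) ∘ₗ (p₁ ∘ₗ f) + (g ∘ₗ i₂) ∘ₗ (p₂ ∘ₗ f) := by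
        conv_lhs => rw [← LinearMap.id_comp f, ← hid]
        simp only [LinearMap.add_comp, LinearMap.comp_add, LinearMap.comp_assoc]
      rw [this] at hg
      exact (IsLocalRing.isUnit_or_isUnit_of_isUnit_add hg).elim (hf₁ _) (hf₂ _)
    · exact fun hf => ⟨fun g hg => hf (g ∘ₗ p₁) hg, fun g hg => hf (g ∘ₗ p₂) hg⟩
  rw [← Module.length_prod, ← hker]
  exact (Φ.quotKerEquivOfSurjective hΦ).length_eq

end Multiplicity

/-- For an indecomposable non-projective `Z`, the multiplicity of `Z` as a direct summand
defines a homomorphism on `K₀`. -/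
theorem exists_multiplicity (R : Type*) [CommRing R] [IsArtinianRing R] [Algebra R S]
    [Module.Finite R S] [IsArtinianRing S] {Z : FGMod S} (hZ : Z.Indec) (hZP : ¬ Z.IsProj) :
    ∃ m : K0 S →+ ℤ, ∀ M : FGMod S, 0 ≤ m (toK0 M) ∧ (m (toK0 M) = 0 ↔ ¬ IsSummand Z M) := by
  have := hZ.isLocalRing
  let _ : ∀ M : FGMod S, Module R M.carrier := fun M => Module.compHom M.carrier (algebraMap R S)
  have : ∀ M : FGMod S, IsScalarTower R S M.carrier := fun M =>
    ⟨fun r s x => by rw [Algebra.smul_def, mul_smul]; rfl⟩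
  have : ∀ M : FGMod S, Module.Finite R M.carrier := fun M => Module.Finite.trans S M.carrier
  have : ∀ M : FGMod S, Module.Finite R (Z.carrier →ₗ[S] M.carrier) := fun M =>
    finite_linearMap R Z.carrier M.carrier
  let q (M : FGMod S) : ℕ∞ := Module.length R ((Z.carrier →ₗ[S] M.carrier) ⧸
    radHom S R Z.carrier M.carrier)
  have hq (M : FGMod S) : q M ≠ ⊤ := Module.length_ne_top
  have hq0 (M : FGMod S) : q M = 0 ↔ ¬ IsSummand Z M := by
    rw [Module.length_eq_zero_iff, Submodule.Quotient.subsingleton_iff,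
      Submodule.eq_top_iff']
    constructor
    · intro h hs
      obtain ⟨i, p, hip⟩ := hs.exists_retraction
      exact h i p (hip ▸ isUnit_one)
    · exact fun h f g hfg => h (Indec.isSummand_of_isUnit f g hfg)
  have hadd (M M₁ M₂ : FGMod S) (e : M.carrier ≃ₗ[S] M₁.carrier × M₂.carrier) :
      q M = q M₁ + q M₂ := length_quotient_radHom_add S R Z.carrier e
  let φ : FreeAbelianGroup (FGMod S) →+ ℤ := FreeAbelianGroup.lift fun M => ((q M).toNat : ℤ)
  have hφ (M : FGMod S) : φ (FreeAbelianGroup.of M) = ((q M).toNat : ℤ) :=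
    FreeAbelianGroup.lift_apply_of _ _
  have hle : K0Rels S ≤ φ.ker := by
    refine (AddSubgroup.closure_le _).2 ?_
    rintro _ (⟨M, M₁, M₂, ⟨e⟩, rfl⟩ | ⟨P, hP, rfl⟩)
    · rw [SetLike.mem_coe, AddMonoidHom.mem_ker, map_sub, map_sub, hφ, hφ, hφ, hadd M M₁ M₂ e,
        ENat.toNat_add (hq _) (hq _)]
      push_cast
      ring
    · rw [SetLike.mem_coe, AddMonoidHom.mem_ker, hφ,
        (hq0 P).2 fun h => hZP (hP.of_isSummand h)]
      rfl
  refine ⟨QuotientAddGroup.lift (K0Rels S) φ hle, fun M => ?_⟩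
  have hm : QuotientAddGroup.lift (K0Rels S) φ hle (toK0 M) = ((q M).toNat : ℤ) := hφ M
  rw [hm, ← hq0]
  refine ⟨Int.natCast_nonneg _, ?_⟩
  rw [Int.natCast_eq_zero, ENat.toNat_eq_zero]
  simp [hq]

theorem toK0_of_equiv_prod {M M₁ M₂ : FGMod S} (e : M.carrier ≃ₗ[S] M₁.carrier × M₂.carrier) :
    toK0 M = toK0 M₁ + toK0 M₂ := by
  refine QuotientAddGroup.eq_iff_sub_mem.2
    (AddSubgroup.subset_closure (Or.inl ⟨M, M₁, M₂, ⟨e⟩, ?_⟩))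
  rw [sub_add_eq_sub_sub]

theorem toK0_eq_zero {P : FGMod S} (hP : P.IsProj) : toK0 P = 0 :=
  (QuotientAddGroup.eq_zero_iff _).2 (AddSubgroup.subset_closure (Or.inr ⟨P, hP, rfl⟩))

theorem mem_of_isSummand [IsNoetherianRing S] {D : Set (FGMod S)} (hD : D = addOf D)
    {N M : FGMod S} (hM : M ∈ D) (h : IsSummand N M) : N ∈ D := by
  rw [hD]
  exact ⟨1, fun _ => M, fun _ => hM,
    h.trans (.of_equiv (N := M) (LinearEquiv.funUnique (Fin 1) S M.carrier))⟩

/-- Up to projectives and modules of `D`, only finitely many indecomposable modules occur as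
direct summands of modules of `C`. -/
def FiniteTypeMod (D C : Set (FGMod S)) : Prop :=
  ∃ G : FGMod S, ∀ M ∈ C, ∀ Z : FGMod S, Z.Indec → IsSummand Z M →
    Z.IsProj ∨ Z ∈ D ∨ IsSummand Z G

theorem exists_detecting_module (x : K0 S) :
    ∃ G : FGMod S, ∀ m : K0 S →+ ℤ, (∀ M, 0 ≤ m (toK0 M)) → m (toK0 G) = 0 → m x = 0 := by
  obtain ⟨y, rfl⟩ := QuotientAddGroup.mk_surjective x
  induction y using FreeAbelianGroup.induction_on with
  | zero => exact ⟨zeroMod S, fun m _ _ => map_zero m⟩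
  | of M => exact ⟨M, fun m _ h => h⟩
  | neg M _ => exact ⟨M, fun m _ h => (map_neg m (toK0 M)).trans (by rw [h, neg_zero])⟩
  | add y z hy hz =>
    obtain ⟨G, hG⟩ := hy
    obtain ⟨G', hG'⟩ := hz
    refine ⟨prodMod G G', fun m hm h => ?_⟩
    rw [toK0_of_equiv_prod (LinearEquiv.refl S (G.carrier × G'.carrier)), map_add] at h
    have h₁ := hm G
    have h₂ := hm G'
    rw [QuotientAddGroup.mk_add, map_add, hG m hm (by omega), hG' m hm (by omega), add_zero]

theorem exists_detecting_module_of_finite {D : Set (FGMod S)} {s : Set (KD D)} (hs : s.Finite) :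
    ∃ G : FGMod S, ∀ m : KD D →+ ℤ, (∀ M, 0 ≤ m (toKD D M)) → m (toKD D G) = 0 →
      ∀ x ∈ s, m x = 0 := by
  induction s, hs using Set.Finite.induction_on with
  | empty => exact ⟨zeroMod S, by simp⟩
  | @insert a s _ _ ih =>
    obtain ⟨G, hG⟩ := ih
    obtain ⟨y, rfl⟩ := QuotientAddGroup.mk_surjective a
    obtain ⟨G', hG'⟩ := exists_detecting_module y
    refine ⟨prodMod G G', fun m hm h => ?_⟩
    have hprod : toKD D (prodMod G G') = toKD D G + toKD D G' :=
      congrArg (QuotientAddGroup.mk' (grpOf D))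
        (toK0_of_equiv_prod (LinearEquiv.refl S (G.carrier × G'.carrier)))
    rw [hprod, map_add] at h
    have h₁ := hm G
    have h₂ := hm G'
    rintro x (rfl | hx)
    · exact hG' (m.comp (QuotientAddGroup.mk' (grpOf D))) hm
        (show m (toKD D G') = 0 by omega)
    · exact hG m hm (by omega) x hx

theorem finiteTypeMod_of_fg (R : Type*) [CommRing R] [IsArtinianRing R] [Algebra R S]
    [Module.Finite R S] [IsArtinianRing S] {D C : Set (FGMod S)} (hD : D = addOf D)
    (h : (classGrpD D C).FG) : FiniteTypeMod D C := by
  obtain ⟨s, hs⟩ := h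
  obtain ⟨G, hG⟩ := exists_detecting_module_of_finite s.finite_toSet
  refine ⟨G, fun M hM Z hZ hZM => ?_⟩
  by_contra! hcon
  obtain ⟨hZP, hZD, hZG⟩ := hcon
  obtain ⟨m, hm⟩ := exists_multiplicity R hZ hZP
  have hle : grpOf D ≤ m.ker := by
    refine (AddSubgroup.closure_le _).2 ?_
    rintro _ ⟨N, K, hK, hNK, rfl⟩
    exact (hm N).2.2 fun hZN => hZD (mem_of_isSummand hD hK (hZN.trans hNK))
  have hs0 := hG (QuotientAddGroup.lift (grpOf D) m hle) (fun M => (hm M).1) ((hm G).2.2 hZG)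
  have hcl : classGrpD D C ≤ (QuotientAddGroup.lift (grpOf D) m hle).ker := by
    rw [← hs]
    exact (AddSubgroup.closure_le _).2 hs0
  have hZ0 : m (toK0 Z) = 0 := hcl (AddSubgroup.mem_map_of_mem (QuotientAddGroup.mk' (grpOf D))
    (AddSubgroup.subset_closure ⟨Z, M, hM, hZM, rfl⟩))
  exact (hm Z).2.1 hZ0 (.of_equiv (LinearEquiv.refl S _))

theorem exists_finite_toK0 [IsArtinianRing S] (G : FGMod S) :
    ∃ s : Set (K0 S), s.Finite ∧ ∀ Z : FGMod S, Z.Indec → IsSummand Z G → toK0 Z ∈ s := by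
  induction G using indecInduction with
  | zero M hM => exact ⟨∅, Set.finite_empty, fun Z hZ h => hZ.not_isSummand_of_subsingleton hM h⟩
  | indec M hM =>
    refine ⟨{toK0 M}, Set.finite_singleton _, fun Z hZ h => ?_⟩
    obtain ⟨e⟩ := hZ.nonempty_equiv_of_isSummand hM h
    have := toK0_of_equiv_prod (M₂ := zeroMod S)
      (e.trans (LinearEquiv.prodUnique (R := S) (M := Z.carrier) (M₂ := PUnit.{u + 1})).symm)
    rw [toK0_eq_zero isProj_zeroMod, add_zero] at this
    exact this.symm
  | prod M M₁ M₂ e h₁ h₂ =>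
    obtain ⟨e⟩ := e
    obtain ⟨s₁, hs₁, h₁⟩ := h₁
    obtain ⟨s₂, hs₂, h₂⟩ := h₂
    exact ⟨s₁ ∪ s₂, hs₁.union hs₂, fun Z hZ h => (hZ.isSummand_prod e h).imp (h₁ Z hZ) (h₂ Z hZ)⟩

theorem toK0_mem_of_indec [IsArtinianRing S] {H : AddSubgroup (K0 S)} {M : FGMod S}
    (h : ∀ Z : FGMod S, Z.Indec → IsSummand Z M → toK0 Z ∈ H) : toK0 M ∈ H := by
  induction M using indecInduction with
  | zero M hM => exact toK0_eq_zero (isProj_of_subsingleton hM) ▸ H.zero_mem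
  | indec M hM => exact h M hM (.of_equiv (LinearEquiv.refl S _))
  | prod M M₁ M₂ e h₁ h₂ =>
    obtain ⟨e⟩ := e
    rw [toK0_of_equiv_prod e]
    have hM₁ : IsSummand M₁ M := ⟨M₂, ⟨e⟩⟩
    have hM₂ : IsSummand M₂ M := ⟨M₁, ⟨e.trans (LinearEquiv.prodComm S _ _)⟩⟩
    exact H.add_mem (h₁ fun Z hZ hZM => h Z hZ (hZM.trans hM₁))
      (h₂ fun Z hZ hZM => h Z hZ (hZM.trans hM₂))

theorem addSubgroup_fg_of_le {G : Type*} [AddCommGroup G] {H K : AddSubgroup G} (hK : K.FG)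
    (h : H ≤ K) : H.FG := by
  have hK' : (AddSubgroup.toIntSubmodule K).FG := (Submodule.fg_iff_addSubgroup_fg _).2 hK
  exact (Submodule.fg_iff_addSubgroup_fg (AddSubgroup.toIntSubmodule H)).1 (hK'.of_le h)

theorem fg_of_finiteTypeMod [IsArtinianRing S] {D C : Set (FGMod S)} (h : FiniteTypeMod D C) :
    (classGrpD D C).FG := by
  obtain ⟨G, hG⟩ := h
  obtain ⟨s, hs, hsG⟩ := exists_finite_toK0 G
  have hle : grpOf C ≤ (AddSubgroup.closure (QuotientAddGroup.mk' (grpOf D) '' s)).comap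
      (QuotientAddGroup.mk' (grpOf D)) := by
    refine (AddSubgroup.closure_le _).2 ?_
    rintro _ ⟨N, M, hM, hNM, rfl⟩
    refine toK0_mem_of_indec fun Z hZ hZN => ?_
    rcases hG M hM Z hZ (hZN.trans hNM) with hP | hZD | hZG
    · rw [toK0_eq_zero hP]
      exact zero_mem _
    · have h0 : QuotientAddGroup.mk' (grpOf D) (toK0 Z) = 0 :=
        (QuotientAddGroup.eq_zero_iff _).2
          (AddSubgroup.subset_closure ⟨Z, Z, hZD, .of_equiv (LinearEquiv.refl S _), rfl⟩)
      rw [AddSubgroup.mem_comap, h0]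
      exact zero_mem _
    · exact AddSubgroup.subset_closure (Set.mem_image_of_mem _ (hsG Z hZ hZG))
  have hfg : (AddSubgroup.closure (QuotientAddGroup.mk' (grpOf D) '' s)).FG :=
    (AddSubgroup.fg_iff _).2 ⟨_, rfl, hs.image _⟩
  exact addSubgroup_fg_of_le hfg (AddSubgroup.map_le_iff_le_comap.2 hle)

theorem FGMod.Indec.exists_isSummand_syz [IsArtinianRing S] {W M : FGMod S} (hW : W.Indec)
    (h : IsSummand W (syz M)) :
    W.IsProj ∨ ∃ Z : FGMod S, Z.Indec ∧ IsSummand Z M ∧ IsSummand W (syz Z) := by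
  induction M using indecInduction with
  | zero M hM => exact Or.inl ((isProj_of_subsingleton hM).syz.of_isSummand h)
  | indec M hM => exact Or.inr ⟨M, hM, .of_equiv (LinearEquiv.refl S _), h⟩
  | prod M M₁ M₂ e h₁ h₂ =>
    obtain ⟨e⟩ := e
    have hM₁ : IsSummand M₁ M := ⟨M₂, ⟨e⟩⟩
    have hM₂ : IsSummand M₂ M := ⟨M₁, ⟨e.trans (LinearEquiv.prodComm S _ _)⟩⟩
    rcases (stable_syz_prod e).isSummand_or_isProj hW h with h | h
    · rcases hW.isSummand_prod
        (LinearEquiv.refl S ((syz M₁).carrier × (syz M₂).carrier)) h with h | h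
      · exact (h₁ h).imp_right fun ⟨Z, hZ, hZM, hWZ⟩ => ⟨Z, hZ, hZM.trans hM₁, hWZ⟩
      · exact (h₂ h).imp_right fun ⟨Z, hZ, hZM, hWZ⟩ => ⟨Z, hZ, hZM.trans hM₂, hWZ⟩
    · exact Or.inl h

theorem FiniteTypeMod.syz [IsArtinianRing S] {D C : Set (FGMod S)} (hD : D = addOf D)
    (hDs : ∀ M ∈ D, syz M ∈ D) (h : FiniteTypeMod D C) : FiniteTypeMod D (FGMod.syz '' C) := by
  obtain ⟨G, hG⟩ := h
  refine ⟨FGMod.syz G, ?_⟩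
  rintro _ ⟨M, hM, rfl⟩ W hW hWM
  rcases hW.exists_isSummand_syz hWM with hP | ⟨Z, hZ, hZM, hWZ⟩
  · exact Or.inl hP
  rcases hG M hM Z hZ hZM with hP | hZD | ⟨Z', ⟨e⟩⟩
  · exact Or.inl (hP.syz.of_isSummand hWZ)
  · exact Or.inr (Or.inl (mem_of_isSummand hD (hDs Z hZD) hWZ))
  · rcases (stable_syz_prod e).symm.isSummand_or_isProj hW (hWZ.trans (.prod_left _ _)) with h | h
    · exact Or.inr (Or.inr h)
    · exact Or.inl h

theorem FiniteTypeMod.syz_iterate [IsArtinianRing S] {D C : Set (FGMod S)} (hD : D = addOf D)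
    (hDs : ∀ M ∈ D, FGMod.syz M ∈ D) (h : FiniteTypeMod D C) (n : ℕ) :
    FiniteTypeMod D (FGMod.syz^[n] '' C) := by
  induction n generalizing C with
  | zero => simpa using h
  | succ n ih =>
    rw [Function.iterate_succ, Set.image_comp]
    exact ih (h.syz hD hDs)

theorem FiniteTypeMod.of_stable [IsArtinianRing S] {D C C' : Set (FGMod S)}
    (h : FiniteTypeMod D C) (hC : ∀ M ∈ C', ∃ N ∈ C, Stable M N) : FiniteTypeMod D C' := by
  obtain ⟨G, hG⟩ := h
  refine ⟨G, fun M hM Z hZ hZM => ?_⟩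
  obtain ⟨N, hN, hMN⟩ := hC M hM
  exact (hMN.isSummand_or_isProj hZ hZM).elim (hG N hN Z hZ) Or.inl

theorem FGMod.isProj_syz_iterate_of_pdim_le [IsArtinianRing S] {M : FGMod S} {n : ℕ}
    (h : pdim M ≤ n) : (syz^[n] M).IsProj := by
  have hne : (((↑) : ℕ → ℕ∞) '' {k : ℕ | (syz^[k] M).IsProj}).Nonempty := by
    by_contra hemp
    rw [Set.not_nonempty_iff_eq_empty] at hemp
    rw [pdim, hemp, sInf_empty] at h
    exact absurd h (by simp)
  obtain ⟨k, hk, hkM⟩ := csInf_mem hne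
  have hkn : k ≤ n := by
    rw [pdim, ← hkM] at h
    exact_mod_cast h
  clear h hkM
  induction n, hkn using Nat.le_induction with
  | base => exact hk
  | succ n _ ih =>
    rw [Function.iterate_succ_apply']
    exact ih.syz

/-!
STATEMENT 8 (Proposition, part 2).  With `C₁, C₂, E` as before (every `E ∈ E` sits in
an exact sequence `0 → C₁ → C₂ → E → 0`), if `C₁` is `D`-syzygy finite and
`gldim(C₂) < ∞`, then `E` is `D`-syzygy finite.
-/
theorem stmt_8 (R A : Type u) [CommRing R] [IsArtinianRing R] [Ring A] [Algebra R A]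
    [Module.Finite R A]
    (L : AddMonoid.End (K0 Aᵐᵒᵖ)) (hL : IsSyzEnd L)
    (D : Set (FGMod Aᵐᵒᵖ)) (hD : IsZeroIT L D)
    (C1 C2 E : Set (FGMod Aᵐᵒᵖ))
    (hses : ∀ M ∈ E, ∃ X ∈ C1, ∃ Y ∈ C2, SES X Y M)
    (h1 : DSyzFinite D C1) (h2 : gldim C2 < ⊤) :
    DSyzFinite D E := by
  have : IsArtinianRing Aᵐᵒᵖ := IsArtinianRing.of_finite R Aᵐᵒᵖ
  obtain ⟨hadd, hsyz, -⟩ := hD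
  obtain ⟨k, hk⟩ := h1
  obtain ⟨n, hn⟩ := ENat.ne_top_iff_exists.1 h2.ne
  have hfin := (finiteTypeMod_of_fg R hadd hk).syz_iterate hadd hsyz n
  refine ⟨k + (n + 1), fg_of_finiteTypeMod (hfin.of_stable ?_)⟩
  rintro _ ⟨M, hM, rfl⟩
  obtain ⟨X, hX, Y, hY, hXYM⟩ := hses M hM
  have hYn : pdim Y ≤ n := hn ▸ le_iSup₂ (f := fun M (_ : M ∈ C2) => pdim M) Y hY
  refine ⟨_, ⟨_, ⟨X, hX, rfl⟩, rfl⟩, ?_⟩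
  have key := (hXYM.stable_syz_iterate n (isProj_syz_iterate_of_pdim_le hYn)).syz_iterate k
  rw [← Function.iterate_add_apply, ← Function.iterate_add_apply] at key
  rwa [← Function.iterate_add_apply, add_comm n k]

end LIT
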